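/- Let A be a positively irreducible n×n 0-1 matrix, Σ_A⊂{1,…,n}^ℕ the associated subshift of finite type, τ:{1,…,n}→{1,…,m}, π:{1,…,n}^ℕ→{1,…,m}^ℕ the induced coordinatewise map, Y=π(Σ_A), and E_1,…,E_m as defined. Let α = exp(lim_k (1/k)·log #𝓛_k(Σ_A)) and β = exp(lim_k (1/k)·log #𝓛_k(Y)) (both limits exist by submultiplicativity). Let μ be a Borel probability measure on Σ_A for which there exists c>0 with c⁻¹α^{−k} ≤ μ([I]) ≤ cα^{−k} for all k≥1 and all I∈𝓛_k(Σ_A). Then the following are equivalent: (a) there exists c'>0 such that c'⁻¹β^{−k} ≤ (μ∘π^{−1})([J]) ≤ c'β^{−k} for all k≥1 and all J∈𝓛_k(Y); (b) there exist C>0 and λ∈ℝ such that for all k≥1 and all y_1,…,y_k∈{1,…,m}, either E_{y_1}⋯E_{y_k}=0 or C⁻¹e^{λk} ≤ ‖E_{y_1}⋯E_{y_k}‖ ≤ Ce^{λk}. -/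

import Mathlib

open Filter Real MeasureTheory

/-- The matrix norm `‖A‖ = ∑_{i,j} |A i j|`. -/
noncomputable def mnorm {d : ℕ} (A : Matrix (Fin d) (Fin d) ℝ) : ℝ :=
  ∑ i, ∑ j, |A i j|

/-- The product `M_{j₁} ⋯ M_{jₙ}` along a word `w = j₁⋯jₙ`. -/
noncomputable def wordProd {d k : ℕ} (M : Fin k → Matrix (Fin d) (Fin d) ℝ)
    (w : List (Fin k)) : Matrix (Fin d) (Fin d) ℝ :=
  (w.map M).prod

/-- `𝐌` has a uniform Lyapunov exponent modulo 0. -/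
def HasULE {d k : ℕ} (M : Fin k → Matrix (Fin d) (Fin d) ℝ) : Prop :=
  ∃ C : ℝ, 0 < C ∧ ∃ lam : ℝ, ∀ w : List (Fin k), w ≠ [] →
    wordProd M w = 0 ∨
      (C⁻¹ * Real.exp (lam * w.length) ≤ mnorm (wordProd M w) ∧
        mnorm (wordProd M w) ≤ C * Real.exp (lam * w.length))

/-- `𝐌` is irreducible: no nonzero proper subspace is invariant under all `M i`. -/
def MatIrred {d k : ℕ} (M : Fin k → Matrix (Fin d) (Fin d) ℝ) : Prop :=
  ∀ V : Submodule ℝ (Fin d → ℝ),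
    (∀ i, ∀ v ∈ V, (M i).mulVec v ∈ V) → V = ⊥ ∨ V = ⊤

/-- `𝐌` is positively irreducible. -/
def PosIrred {d k : ℕ} (M : Fin k → Matrix (Fin d) (Fin d) ℝ) : Prop :=
  (∀ i a b, 0 ≤ M i a b) ∧
    ∃ ℓ : ℕ, 1 ≤ ℓ ∧ ∀ a b, 0 < (∑ j ∈ Finset.Icc 1 ℓ, (∑ i, M i) ^ j) a b

/-- A single nonnegative matrix is positively irreducible:
some partial sum of its powers is entrywise positive. -/
def PosIrredMat {n : ℕ} (A : Matrix (Fin n) (Fin n) ℝ) : Prop :=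
  ∃ ℓ : ℕ, 1 ≤ ℓ ∧ ∀ a b, 0 < (∑ j ∈ Finset.Icc 1 ℓ, A ^ j) a b

/-- The subshift of finite type determined by the 0-1 matrix `A`. -/
def sftSet {n : ℕ} (A : Matrix (Fin n) (Fin n) ℝ) : Set (ℕ → Fin n) :=
  {x | ∀ t : ℕ, A (x t) (x (t + 1)) = 1}

/-- The words of length `kk` occurring as consecutive strings in elements of `X`. -/
def lang {α : Type*} (X : Set (ℕ → α)) (kk : ℕ) : Set (Fin kk → α) :=
  {w | ∃ x ∈ X, ∃ p : ℕ, ∀ i : Fin kk, x (p + i) = w i}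

/-- The cylinder set of sequences starting with the word `w`. -/
def cylSet {α : Type*} {kk : ℕ} (w : Fin kk → α) : Set (ℕ → α) :=
  {x | ∀ i : Fin kk, x i = w i}

theorem mnorm_nonneg {d : ℕ} (A : Matrix (Fin d) (Fin d) ℝ) : 0 ≤ mnorm A :=
  Finset.sum_nonneg fun _ _ => Finset.sum_nonneg fun _ _ => abs_nonneg _

theorem eq_zero_of_mnorm_eq_zero {d : ℕ} {A : Matrix (Fin d) (Fin d) ℝ} (h : mnorm A = 0) :
    A = 0 := by
  have h1 := (Finset.sum_eq_zero_iff_of_nonneg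
    fun _ _ => Finset.sum_nonneg fun _ _ => abs_nonneg _).1 h
  ext i j
  have h2 := (Finset.sum_eq_zero_iff_of_nonneg fun _ _ => abs_nonneg _).1 (h1 i (Finset.mem_univ _))
  simpa using h2 j (Finset.mem_univ _)

theorem mnorm_zero {d : ℕ} : mnorm (0 : Matrix (Fin d) (Fin d) ℝ) = 0 := by
  simp [mnorm]

theorem PosIrredMat.exists_row_eq_one {n : ℕ} {A : Matrix (Fin n) (Fin n) ℝ} (h : PosIrredMat A)
    (hA01 : ∀ i j, A i j = 0 ∨ A i j = 1) (v : Fin n) : ∃ w, A v w = 1 := by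
  by_contra! hne
  have h0 : ∀ w, A v w = 0 := fun w => (hA01 v w).resolve_right (hne w)
  obtain ⟨ℓ, -, hpos⟩ := h
  refine (hpos v v).ne' ?_
  rw [Matrix.sum_apply]
  refine Finset.sum_eq_zero fun j hj => ?_
  obtain ⟨i, rfl⟩ := Nat.exists_eq_add_of_le' (Finset.mem_Icc.1 hj).1
  simp [pow_succ', Matrix.mul_apply, h0]

theorem PosIrredMat.exists_col_eq_one {n : ℕ} {A : Matrix (Fin n) (Fin n) ℝ} (h : PosIrredMat A)
    (hA01 : ∀ i j, A i j = 0 ∨ A i j = 1) (w : Fin n) : ∃ v, A v w = 1 := by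
  by_contra! hne
  have h0 : ∀ v, A v w = 0 := fun v => (hA01 v w).resolve_right (hne v)
  obtain ⟨ℓ, -, hpos⟩ := h
  refine (hpos w w).ne' ?_
  rw [Matrix.sum_apply]
  refine Finset.sum_eq_zero fun j hj => ?_
  obtain ⟨i, rfl⟩ := Nat.exists_eq_add_of_le' (Finset.mem_Icc.1 hj).1
  simp [pow_succ, Matrix.mul_apply, h0]

/-- Every finite path extends to an infinite one when each vertex has a successor. -/
theorem exists_sftSet_extending {n : ℕ} {A : Matrix (Fin n) (Fin n) ℝ}
    (hrow : ∀ v, ∃ w, A v w = 1) (k : ℕ) (z : Fin (k + 1) → Fin n)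
    (hz : ∀ t : Fin k, A (z t.castSucc) (z t.succ) = 1) :
    ∃ s ∈ sftSet A, ∀ i : Fin (k + 1), s i = z i := by
  induction k with
  | zero =>
    choose f hf using hrow
    refine ⟨fun t => f^[t] (z 0), fun t => ?_, fun i => ?_⟩
    · simpa only [Function.iterate_succ_apply'] using hf _
    · obtain rfl : i = 0 := Fin.ext (by omega)
      rfl
  | succ k ih =>
    obtain ⟨s, hs, hsz⟩ := ih (fun i => z i.succ) fun t => by simpa using hz t.succ
    refine ⟨fun t => Nat.casesOn t (z 0) s, fun t => ?_, fun i => ?_⟩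
    · cases t with
      | zero => simpa [show s 0 = z 1 from hsz 0] using hz 0
      | succ t => exact hs t
    · cases i using Fin.cases with
      | zero => rfl
      | succ i => simpa using hsz i

/-- Row sums of a product of matrices, expanded over paths. -/
theorem sum_wordProd_apply {n m : ℕ} (E : Fin m → Matrix (Fin n) (Fin n) ℝ) (k : ℕ)
    (y : Fin k → Fin m) (i : Fin n) :
    ∑ j, wordProd E (List.ofFn y) i j =
      ∑ x : Fin k → Fin n,
        ∏ t : Fin k, E (y t) ((Fin.cons i x : Fin (k + 1) → Fin n) t.castSucc) (x t) := by
  induction k generalizing i with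
  | zero => simp [wordProd, Matrix.one_apply]
  | succ k ih =>
    have hstep : ∀ j, wordProd E (List.ofFn y) i j =
        ∑ l, E (y 0) i l * wordProd E (List.ofFn fun t : Fin k => y t.succ) l j := fun j => by
      simp [wordProd, List.ofFn_succ, Matrix.mul_apply]
    simp_rw [hstep]
    rw [Finset.sum_comm]
    simp_rw [← Finset.mul_sum, ih]
    rw [← (Fin.consEquiv fun _ : Fin (k + 1) => Fin n).sum_comp, Fintype.sum_prod_type]
    refine Finset.sum_congr rfl fun l _ => ?_
    rw [Finset.mul_sum]
    refine Finset.sum_congr rfl fun x _ => ?_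
    simp [Fin.consEquiv, Fin.prod_univ_succ]

theorem wordProd_nonneg {n m : ℕ} {E : Fin m → Matrix (Fin n) (Fin n) ℝ}
    (hE : ∀ ℓ i j, 0 ≤ E ℓ i j) (w : List (Fin m)) (i j : Fin n) : 0 ≤ wordProd E w i j := by
  induction w generalizing i j with
  | nil =>
    simp only [wordProd, List.map_nil, List.prod_nil, Matrix.one_apply]
    split_ifs <;> norm_num
  | cons l w ih =>
    simp only [wordProd, List.map_cons, List.prod_cons, Matrix.mul_apply]
    exact Finset.sum_nonneg fun t _ => mul_nonneg (hE _ _ _) (ih _ _)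

open Classical in
/-- The admissible words of length `k` lying over `y`. -/
noncomputable def fiberWords {n m : ℕ} (A : Matrix (Fin n) (Fin n) ℝ) (τ : Fin n → Fin m) {k : ℕ}
    (y : Fin k → Fin m) : Finset (Fin k → Fin n) :=
  {x | x ∈ lang (sftSet A) k ∧ τ ∘ x = y}

theorem mem_fiberWords {n m : ℕ} {A : Matrix (Fin n) (Fin n) ℝ} {τ : Fin n → Fin m} {k : ℕ}
    {y : Fin k → Fin m} {x : Fin k → Fin n} :
    x ∈ fiberWords A τ y ↔ x ∈ lang (sftSet A) k ∧ τ ∘ x = y := by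
  simp [fiberWords]

theorem fiberWords_nonempty_iff {n m : ℕ} {A : Matrix (Fin n) (Fin n) ℝ} {τ : Fin n → Fin m}
    {k : ℕ} {y : Fin k → Fin m} :
    (fiberWords A τ y).Nonempty ↔ y ∈ lang ((fun x => τ ∘ x) '' sftSet A) k := by
  constructor
  · rintro ⟨x, hx⟩
    obtain ⟨⟨s, hs, p, hp⟩, rfl⟩ := mem_fiberWords.1 hx
    exact ⟨_, ⟨s, hs, rfl⟩, p, fun i => by simp [hp]⟩
  · rintro ⟨_, ⟨s, hs, rfl⟩, p, hp⟩
    exact ⟨fun i => s (p + i), mem_fiberWords.2 ⟨⟨s, hs, p, fun _ => rfl⟩, funext hp⟩⟩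

theorem prod_path_eq_ite {n m : ℕ} {A : Matrix (Fin n) (Fin n) ℝ}
    (hA01 : ∀ i j, A i j = 0 ∨ A i j = 1) {τ : Fin n → Fin m}
    {E : Fin m → Matrix (Fin n) (Fin n) ℝ}
    (hE : ∀ ℓ i j, E ℓ i j = if τ j = ℓ then A i j else 0) {k : ℕ} (y : Fin k → Fin m)
    (x : Fin k → Fin n) (i : Fin n) [Decidable (τ ∘ x = y ∧
      ∀ t : Fin k, A ((Fin.cons i x : Fin (k + 1) → Fin n) t.castSucc) (x t) = 1)] :
    ∏ t : Fin k, E (y t) ((Fin.cons i x : Fin (k + 1) → Fin n) t.castSucc) (x t) =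
      if τ ∘ x = y ∧ ∀ t : Fin k, A ((Fin.cons i x : Fin (k + 1) → Fin n) t.castSucc) (x t) = 1
        then 1 else 0 := by
  split_ifs with h
  · obtain ⟨rfl, h⟩ := h
    exact Finset.prod_eq_one fun t _ => by simp [hE, h]
  · rw [Finset.prod_eq_zero_iff]
    by_contra! hne
    have hne' : ∀ t, τ (x t) = y t ∧
        A ((Fin.cons i x : Fin (k + 1) → Fin n) t.castSucc) (x t) ≠ 0 := fun t => by
      have := hne t (Finset.mem_univ t)
      rw [hE] at this
      simpa using this
    exact h ⟨funext fun t => (hne' t).1, fun t => (hA01 _ _).resolve_left (hne' t).2⟩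

theorem mem_lang_sftSet_iff {n : ℕ} {A : Matrix (Fin n) (Fin n) ℝ}
    (hrow : ∀ v, ∃ w, A v w = 1) (hcol : ∀ w, ∃ v, A v w = 1) {k : ℕ} (hk : 1 ≤ k)
    (x : Fin k → Fin n) :
    x ∈ lang (sftSet A) k ↔
      ∃ i, ∀ t : Fin k, A ((Fin.cons i x : Fin (k + 1) → Fin n) t.castSucc) (x t) = 1 := by
  constructor
  · rintro ⟨s, hs, p, hp⟩
    obtain ⟨k, rfl⟩ := Nat.exists_eq_add_of_le' hk
    obtain ⟨i, hi⟩ := hcol (x 0)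
    refine ⟨i, fun t => ?_⟩
    cases t using Fin.cases with
    | zero => simpa using hi
    | succ t =>
      have := hs (p + t)
      rw [show s (p + t) = x t.castSucc from hp t.castSucc,
        show s (p + t + 1) = x t.succ by simpa [add_assoc] using hp t.succ] at this
      simpa [← Fin.succ_castSucc] using this
  · rintro ⟨i, hi⟩
    obtain ⟨s, hs, hsz⟩ := exists_sftSet_extending hrow k (Fin.cons i x) (by simpa using hi)
    exact ⟨s, hs, 1, fun t => by simpa [add_comm] using hsz t.succ⟩

theorem card_fiberWords_le_mnorm_and_le {n m : ℕ} {A : Matrix (Fin n) (Fin n) ℝ}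
    (hA01 : ∀ i j, A i j = 0 ∨ A i j = 1) (hirr : PosIrredMat A) {τ : Fin n → Fin m}
    {E : Fin m → Matrix (Fin n) (Fin n) ℝ}
    (hE : ∀ ℓ i j, E ℓ i j = if τ j = ℓ then A i j else 0) {k : ℕ} (hk : 1 ≤ k)
    (y : Fin k → Fin m) :
    ((fiberWords A τ y).card : ℝ) ≤ mnorm (wordProd E (List.ofFn y)) ∧
      mnorm (wordProd E (List.ofFn y)) ≤ n * (fiberWords A τ y).card := by
  classical
  have hE0 : ∀ ℓ i j, 0 ≤ E ℓ i j := fun ℓ i j => by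
    rw [hE]
    rcases hA01 i j with h | h <;> simp [h]
    split_ifs <;> norm_num
  have hlang := mem_lang_sftSet_iff (hirr.exists_row_eq_one hA01) (hirr.exists_col_eq_one hA01) hk
  have hnorm : mnorm (wordProd E (List.ofFn y)) = ∑ x : Fin k → Fin n, ∑ i : Fin n,
      if τ ∘ x = y ∧ ∀ t : Fin k, A ((Fin.cons i x : Fin (k + 1) → Fin n) t.castSucc) (x t) = 1
        then (1 : ℝ) else 0 := by
    simp_rw [mnorm, abs_of_nonneg (wordProd_nonneg hE0 _ _ _), sum_wordProd_apply,
      prod_path_eq_ite hA01 hE]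
    exact Finset.sum_comm
  have hcard : ((fiberWords A τ y).card : ℝ) =
      ∑ x : Fin k → Fin n, if x ∈ lang (sftSet A) k ∧ τ ∘ x = y then (1 : ℝ) else 0 := by
    rw [Finset.sum_boole, fiberWords]
  rw [hnorm, hcard]
  constructor
  · refine Finset.sum_le_sum fun x _ => ?_
    split_ifs with hx
    · obtain ⟨i, hi⟩ := (hlang x).1 hx.1
      refine le_trans ?_ (Finset.single_le_sum (fun _ _ => by split_ifs <;> norm_num)
        (Finset.mem_univ i))
      rw [if_pos ⟨hx.2, hi⟩]
    · exact Finset.sum_nonneg fun _ _ => by split_ifs <;> norm_num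
  · rw [Finset.mul_sum]
    refine Finset.sum_le_sum fun x _ => ?_
    have : (n : ℝ) * (if x ∈ lang (sftSet A) k ∧ τ ∘ x = y then (1 : ℝ) else 0) =
        ∑ _i : Fin n, if x ∈ lang (sftSet A) k ∧ τ ∘ x = y then (1 : ℝ) else 0 := by simp
    rw [this]
    refine Finset.sum_le_sum fun i _ => ?_
    split_ifs with h1 h2
    · exact le_rfl
    · exact absurd ⟨(hlang x).2 ⟨i, h1.2⟩, h1.1⟩ h2
    · exact zero_le_one
    · exact le_rfl

theorem cylSet_eq_preimage {α : Type*} {k : ℕ} (w : Fin k → α) :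
    cylSet w = (fun (x : ℕ → α) (i : Fin k) => x i) ⁻¹' {w} := by
  ext x
  simp [cylSet, funext_iff]

theorem measurableSet_cylSet {α : Type*} [MeasurableSpace α] [MeasurableSingletonClass α]
    {k : ℕ} (w : Fin k → α) : MeasurableSet (cylSet w) := by
  rw [cylSet_eq_preimage]
  exact measurable_pi_lambda _ (fun i => measurable_pi_apply _) (measurableSet_singleton w)

theorem sum_measureReal_cylSet {α : Type*} [MeasurableSpace α] [MeasurableSingletonClass α]
    {k : ℕ} (ν : Measure (ℕ → α)) [IsFiniteMeasure ν] (s : Finset (Fin k → α)) :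
    ∑ w ∈ s, ν.real (cylSet w) = ν.real {x | (fun i : Fin k => x i) ∈ s} := by
  simp_rw [cylSet_eq_preimage]
  rw [sum_measureReal_preimage_singleton]
  · rfl
  · intro w _
    rw [← cylSet_eq_preimage]
    exact measurableSet_cylSet w

theorem measurableSet_sftSet {n : ℕ} (A : Matrix (Fin n) (Fin n) ℝ) :
    MeasurableSet (sftSet A) := by
  rw [sftSet, Set.ofPred_forall]
  refine MeasurableSet.iInter fun t => ?_
  have hm : Measurable fun x : ℕ → Fin n => (x t, x (t + 1)) :=
    (measurable_pi_apply _).prodMk (measurable_pi_apply _)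
  exact hm (MeasurableSet.of_discrete (s := {q : Fin n × Fin n | A q.1 q.2 = 1}))

theorem measurable_comp_left {n m : ℕ} (τ : Fin n → Fin m) :
    Measurable fun x : ℕ → Fin n => τ ∘ x :=
  measurable_pi_lambda _ fun t => (measurable_of_finite τ).comp (measurable_pi_apply t)

/-- The measure of an image cylinder, decomposed over the admissible words above it. -/
theorem map_measureReal_cylSet {n m : ℕ} (A : Matrix (Fin n) (Fin n) ℝ) (τ : Fin n → Fin m)
    (μ : Measure (ℕ → Fin n)) [IsProbabilityMeasure μ] (hsupp : μ (sftSet A) = 1) {k : ℕ}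
    (y : Fin k → Fin m) :
    (μ.map fun x => τ ∘ x).real (cylSet y) = ∑ x ∈ fiberWords A τ y, μ.real (cylSet x) := by
  rw [sum_measureReal_cylSet,
    map_measureReal_apply (measurable_comp_left τ) (measurableSet_cylSet y)]
  refine measureReal_congr ?_
  have hae : ∀ᵐ x ∂μ, x ∈ sftSet A :=
    (mem_ae_iff_prob_eq_one (measurableSet_sftSet A)).2 hsupp
  filter_upwards [hae] with x hx
  refine propext ?_
  change (∀ i : Fin k, (τ ∘ x) i = y i) ↔ (fun i : Fin k => x i) ∈ fiberWords A τ y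
  rw [mem_fiberWords]
  exact ⟨fun h => ⟨⟨x, hx, 0, fun i => by simp⟩, funext h⟩, fun h => congrFun h.2⟩

/-- A sequence comparable to `exp (d * k)` has exponential growth rate `d`. -/
theorem tendsto_inv_mul_log_of_comparable_exp {u : ℕ → ℝ} {C d : ℝ} (hC : 0 < C)
    (h : ∀ k : ℕ, 1 ≤ k → C⁻¹ * exp (d * k) ≤ u k ∧ u k ≤ C * exp (d * k)) :
    Tendsto (fun k : ℕ => (k : ℝ)⁻¹ * log (u k)) atTop (nhds d) := by
  have hinv : Tendsto (fun k : ℕ => (k : ℝ)⁻¹ * log C) atTop (nhds 0) := by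
    simpa using (tendsto_inv_atTop_nhds_zero_nat (𝕜 := ℝ)).mul_const (log C)
  have hlow : Tendsto (fun k : ℕ => d - (k : ℝ)⁻¹ * log C) atTop (nhds d) := by
    simpa using hinv.const_sub d
  have hupp : Tendsto (fun k : ℕ => d + (k : ℝ)⁻¹ * log C) atTop (nhds d) := by
    simpa using hinv.const_add d
  refine tendsto_of_tendsto_of_tendsto_of_le_of_le' hlow hupp ?_ ?_ <;>
    filter_upwards [eventually_ge_atTop 1] with k hk
  all_goals
    have hk0 : (0 : ℝ) < k := by exact_mod_cast hk
    obtain ⟨h1, h2⟩ := h k hk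
    have hpos : 0 < C⁻¹ * exp (d * k) := by positivity
  · have := log_le_log hpos h1
    rw [log_mul (by positivity) (by positivity), log_exp, log_inv] at this
    calc d - (k : ℝ)⁻¹ * log C = (k : ℝ)⁻¹ * (-log C + d * k) := by field_simp; ring
      _ ≤ _ := by gcongr
  · have := log_le_log (hpos.trans_le h1) h2
    rw [log_mul (by positivity) (by positivity), log_exp] at this
    calc (k : ℝ)⁻¹ * log (u k) ≤ (k : ℝ)⁻¹ * (log C + d * k) := by gcongr
      _ = _ := by field_simp; ring

/-- If a probability measure gives the words of a language measures comparable to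
`exp (-(d * k))` and charges no other word, then `d` is the growth rate of the language. -/
theorem growth_rate_eq_of_measureReal_cylSet {m : ℕ} (X : Set (ℕ → Fin m)) (ν : Measure (ℕ → Fin m))
    [IsProbabilityMeasure ν] {b d C : ℝ} (hC : 0 < C)
    (hb : Tendsto (fun k : ℕ => (k : ℝ)⁻¹ * log (Set.ncard (lang X k))) atTop (nhds b))
    (hzero : ∀ k, 1 ≤ k → ∀ J ∉ lang X k, ν.real (cylSet J) = 0)
    (hν : ∀ k : ℕ, 1 ≤ k → ∀ J ∈ lang X k,
      C⁻¹ * exp (-d * k) ≤ ν.real (cylSet J) ∧ ν.real (cylSet J) ≤ C * exp (-d * k)) :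
    b = d := by
  classical
  refine tendsto_nhds_unique hb (tendsto_inv_mul_log_of_comparable_exp hC fun k hk => ?_)
  have hsum : ∑ J ∈ (lang X k).toFinset, ν.real (cylSet J) = 1 := by
    rw [Finset.sum_subset (Finset.subset_univ _)
      fun J _ hJ => hzero k hk J (by simpa using hJ), sum_measureReal_cylSet]
    simp
  have h1 := Finset.card_nsmul_le_sum (lang X k).toFinset (fun J => ν.real (cylSet J)) _
    fun J hJ => (hν k hk J (by simpa using hJ)).1
  have h2 := Finset.sum_le_card_nsmul (lang X k).toFinset (fun J => ν.real (cylSet J)) _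
    fun J hJ => (hν k hk J (by simpa using hJ)).2
  rw [hsum, nsmul_eq_mul, ← Set.ncard_eq_toFinset_card', neg_mul, exp_neg] at h1 h2
  have he := exp_pos (d * k)
  constructor
  · rw [inv_mul_le_iff₀ hC]
    calc exp (d * k) = exp (d * k) * 1 := (mul_one _).symm
      _ ≤ exp (d * k) * (_ * (C * (exp (d * k))⁻¹)) := by gcongr
      _ = _ := by field_simp
  · calc ((lang X k).ncard : ℝ)
        = C * exp (d * k) * ((lang X k).ncard * (C⁻¹ * (exp (d * k))⁻¹)) := by field_simp
      _ ≤ C * exp (d * k) * 1 := by gcongr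
      _ = _ := mul_one _

theorem stmt15 {n m : ℕ} [NeZero n] [NeZero m]
    (A : Matrix (Fin n) (Fin n) ℝ)
    (hA01 : ∀ i j, A i j = 0 ∨ A i j = 1)
    (hirr : PosIrredMat A)
    (τ : Fin n → Fin m)
    (E : Fin m → Matrix (Fin n) (Fin n) ℝ)
    (hE : ∀ ℓ i j, E ℓ i j = if τ j = ℓ then A i j else 0)
    (a b : ℝ)
    (ha : Tendsto (fun kk : ℕ =>
        (kk : ℝ)⁻¹ * Real.log (Set.ncard (lang (sftSet A) kk))) atTop (nhds a))
    (hb : Tendsto (fun kk : ℕ =>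
        (kk : ℝ)⁻¹ * Real.log (Set.ncard (lang ((fun x => τ ∘ x) '' sftSet A) kk)))
      atTop (nhds b))
    (μ : Measure (ℕ → Fin n)) [IsProbabilityMeasure μ]
    (hsupp : μ (sftSet A) = 1)
    (c : ℝ) (hc : 0 < c)
    (hμ : ∀ (kk : ℕ), 1 ≤ kk → ∀ I ∈ lang (sftSet A) kk,
      ENNReal.ofReal (c⁻¹ * (Real.exp a ^ kk)⁻¹) ≤ μ (cylSet I) ∧
      μ (cylSet I) ≤ ENNReal.ofReal (c * (Real.exp a ^ kk)⁻¹)) :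
    (∃ c' : ℝ, 0 < c' ∧ ∀ (kk : ℕ), 1 ≤ kk →
        ∀ J ∈ lang ((fun x => τ ∘ x) '' sftSet A) kk,
          ENNReal.ofReal (c'⁻¹ * (Real.exp b ^ kk)⁻¹) ≤ (μ.map fun x => τ ∘ x) (cylSet J) ∧
          (μ.map fun x => τ ∘ x) (cylSet J) ≤ ENNReal.ofReal (c' * (Real.exp b ^ kk)⁻¹)) ↔
    (∃ C : ℝ, 0 < C ∧ ∃ lam : ℝ, ∀ (kk : ℕ), 1 ≤ kk → ∀ y : Fin kk → Fin m,
        wordProd E (List.ofFn y) = 0 ∨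
          (C⁻¹ * Real.exp (lam * kk) ≤ mnorm (wordProd E (List.ofFn y)) ∧
            mnorm (wordProd E (List.ofFn y)) ≤ C * Real.exp (lam * kk))) := by
  have hn : (0 : ℝ) < n := by exact_mod_cast Nat.pos_of_ne_zero (NeZero.ne n)
  have : IsProbabilityMeasure (μ.map fun x => τ ∘ x) :=
    Measure.isProbabilityMeasure_map (measurable_comp_left τ).aemeasurable
  set ν := μ.map fun x => τ ∘ x with hν
  set Y := (fun x => τ ∘ x) '' sftSet A with hY
  have hexp : ∀ (r : ℝ) (k : ℕ), (exp r ^ k)⁻¹ = exp (-r * k) := fun r k => by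
    rw [← exp_nat_mul, ← exp_neg]
    ring_nf
  have hofReal : ∀ (ρ : ℝ) (s : Set (ℕ → Fin m)) (k : ℕ), 0 < ρ →
      ((ENNReal.ofReal (ρ⁻¹ * (exp b ^ k)⁻¹) ≤ ν s ∧ ν s ≤ ENNReal.ofReal (ρ * (exp b ^ k)⁻¹)) ↔
        (ρ⁻¹ * exp (-b * k) ≤ ν.real s ∧ ν.real s ≤ ρ * exp (-b * k))) := fun ρ s k hρ => by
    rw [hexp, ENNReal.ofReal_le_iff_le_toReal (measure_ne_top _ _),
      ENNReal.le_ofReal_iff_toReal_le (measure_ne_top _ _) (by positivity)]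
    rfl
  have hcard := fun (k : ℕ) (hk : 1 ≤ k) (y : Fin k → Fin m) =>
    card_fiberWords_le_mnorm_and_le hA01 hirr hE hk y
  have hzero : ∀ k : ℕ, ∀ J : Fin k → Fin m, J ∉ lang Y k → fiberWords A τ J = ∅ :=
    fun k J hJ => Finset.not_nonempty_iff_eq_empty.1 fun h => hJ (fiberWords_nonempty_iff.1 h)
  -- cylinder measures are comparable to `mnorm` times `exp (-a * k)`
  have hcmp : ∀ k : ℕ, 1 ≤ k → ∀ J : Fin k → Fin m,
      (c * n)⁻¹ * (mnorm (wordProd E (List.ofFn J)) * exp (-a * k)) ≤ ν.real (cylSet J) ∧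
      ν.real (cylSet J) ≤ c * n * (mnorm (wordProd E (List.ofFn J)) * exp (-a * k)) := by
    intro k hk J
    have hμ' : ∀ x ∈ fiberWords A τ J,
        c⁻¹ * exp (-a * k) ≤ μ.real (cylSet x) ∧ μ.real (cylSet x) ≤ c * exp (-a * k) := by
      intro x hx
      have := hμ k hk x (mem_fiberWords.1 hx).1
      rwa [hexp, ENNReal.ofReal_le_iff_le_toReal (measure_ne_top _ _),
        ENNReal.le_ofReal_iff_toReal_le (measure_ne_top _ _) (by positivity)] at this
    have h1 := Finset.card_nsmul_le_sum _ _ _ fun x hx => (hμ' x hx).1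
    have h2 := Finset.sum_le_card_nsmul _ _ _ fun x hx => (hμ' x hx).2
    rw [← map_measureReal_cylSet A τ μ hsupp, nsmul_eq_mul] at h1 h2
    obtain ⟨h3, h4⟩ := hcard k hk J
    have hn1 : (1 : ℝ) ≤ n := by exact_mod_cast NeZero.one_le
    have hm0 := mnorm_nonneg (wordProd E (List.ofFn J))
    constructor
    · calc _ ≤ (c * n)⁻¹ * (n * (fiberWords A τ J).card * exp (-a * k)) := by gcongr
        _ = (fiberWords A τ J).card * (c⁻¹ * exp (-a * k)) := by field_simp
        _ ≤ _ := h1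
    · calc _ ≤ (fiberWords A τ J).card * (c * exp (-a * k)) := h2
        _ ≤ mnorm (wordProd E (List.ofFn J)) * (c * exp (-a * k)) := by gcongr
        _ = c * 1 * (mnorm (wordProd E (List.ofFn J)) * exp (-a * k)) := by ring
        _ ≤ _ := by gcongr
  have hK : 0 < c * n := by positivity
  constructor
  · rintro ⟨c', hc', h⟩
    refine ⟨c * n * c', by positivity, a - b, fun k hk y => ?_⟩
    by_cases hy : y ∈ lang Y k
    · right
      obtain ⟨h1, h2⟩ := (hofReal c' _ k hc').1 (h k hk y hy)
      obtain ⟨h3, h4⟩ := hcmp k hk y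
      have hab : exp ((a - b) * k) = exp (-b * k) * exp (a * k) := by
        rw [← exp_add]; ring_nf
      have haa : exp (-a * k) * exp (a * k) = 1 := by
        rw [← exp_add]; simp
      rw [hab]
      set M := mnorm (wordProd E (List.ofFn y))
      constructor
      · calc (c * n * c')⁻¹ * (exp (-b * k) * exp (a * k))
            = (c * n)⁻¹ * (c'⁻¹ * exp (-b * k)) * exp (a * k) := by field_simp
          _ ≤ (c * n)⁻¹ * (c * n * (M * exp (-a * k))) * exp (a * k) :=
            mul_le_mul_of_nonneg_right
              (mul_le_mul_of_nonneg_left (h1.trans h4) (by positivity)) (exp_pos _).le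
          _ = M * (exp (-a * k) * exp (a * k)) := by field_simp
          _ = M := by rw [haa, mul_one]
      · calc M = M * (exp (-a * k) * exp (a * k)) := by rw [haa, mul_one]
          _ = c * n * ((c * n)⁻¹ * (M * exp (-a * k))) * exp (a * k) := by field_simp
          _ ≤ c * n * (c' * exp (-b * k)) * exp (a * k) :=
            mul_le_mul_of_nonneg_right
              (mul_le_mul_of_nonneg_left (h3.trans h2) (by positivity)) (exp_pos _).le
          _ = _ := by ring
    · left
      refine eq_zero_of_mnorm_eq_zero (le_antisymm ?_ (mnorm_nonneg _))
      simpa [hzero k y hy] using (hcard k hk y).2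
  · rintro ⟨C, hC, lam, h⟩
    have hY' : ∀ k : ℕ, 1 ≤ k → ∀ J ∈ lang Y k,
        (c * n * C)⁻¹ * exp (-(a - lam) * k) ≤ ν.real (cylSet J) ∧
          ν.real (cylSet J) ≤ c * n * C * exp (-(a - lam) * k) := by
      intro k hk J hJ
      obtain ⟨h3, h4⟩ := hcmp k hk J
      have hne : wordProd E (List.ofFn J) ≠ 0 := fun h0 => by
        have h5 := (hcard k hk J).1
        rw [h0, mnorm_zero] at h5
        have h6 : 0 < (fiberWords A τ J).card :=
          Finset.card_pos.2 (fiberWords_nonempty_iff.2 hJ)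
        exact absurd h5 (not_le.2 (by exact_mod_cast h6))
      obtain ⟨h1, h2⟩ := (h k hk J).resolve_left hne
      have hal : exp (-(a - lam) * k) = exp (lam * k) * exp (-a * k) := by
        rw [← exp_add]; ring_nf
      rw [hal]
      constructor
      · refine le_trans ?_ h3
        calc _ = (c * n)⁻¹ * (C⁻¹ * exp (lam * k) * exp (-a * k)) := by field_simp
          _ ≤ _ := by gcongr
      · refine h4.trans ?_
        calc _ ≤ c * n * (C * exp (lam * k) * exp (-a * k)) := by gcongr
          _ = _ := by ring
    have hbd : b = a - lam := by
      refine growth_rate_eq_of_measureReal_cylSet Y ν (C := c * n * C) (by positivity) hb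
        (fun k _ J hJ => ?_) hY'
      rw [hν, map_measureReal_cylSet A τ μ hsupp, hzero k J hJ, Finset.sum_empty]
    refine ⟨c * n * C, by positivity, fun k hk J hJ => ?_⟩
    rw [hofReal _ _ k (by positivity), hbd]
    exact hY' k hk J hJ
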